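/- For every real x > 0, F(x) + F(1/x) = 2F(1) + (log x)²/2 − π²(x−1)²/(6x). -/

import Mathlib

open Real

/-- The digamma function ψ = Γ′/Γ. -/
noncomputable def digamma (x : ℝ) : ℝ := deriv Real.Gamma x / Real.Gamma x

/-- The Herglotz function F(x) = ∑_{n≥1} (ψ(nx) − log(nx))/n. -/
noncomputable def herglotzF (x : ℝ) : ℝ :=
  ∑' n : ℕ, (digamma (((n : ℝ) + 1) * x) - Real.log (((n : ℝ) + 1) * x)) / ((n : ℝ) + 1)

open Filter Topology Finset

section Digamma

lemma hasDerivAt_log_Gamma {x : ℝ} (hx : 0 < x) :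
    HasDerivAt (fun y ↦ log (Gamma y)) (digamma x) x :=
  (differentiableAt_Gamma fun m ↦ ((neg_nonpos.mpr m.cast_nonneg).trans_lt hx).ne').hasDerivAt.log
    (Gamma_pos_of_pos hx).ne'

lemma log_Gamma_add_one {x : ℝ} (hx : 0 < x) :
    log (Gamma (x + 1)) = log x + log (Gamma x) := by
  rw [Gamma_add_one hx.ne', log_mul hx.ne' (Gamma_pos_of_pos hx).ne']

lemma digamma_add_one {x : ℝ} (hx : 0 < x) : digamma (x + 1) = digamma x + 1 / x := by
  have h₁ : HasDerivAt (fun y ↦ log (Gamma (y + 1))) (digamma (x + 1)) x :=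
    (hasDerivAt_log_Gamma (by positivity : 0 < x + 1)).comp_add_const x 1
  have h₂ := (hasDerivAt_log hx.ne').add (hasDerivAt_log_Gamma hx)
  have h₃ : (fun y ↦ log (Gamma (y + 1))) =ᶠ[𝓝 x] (log + fun y ↦ log (Gamma y)) := by
    filter_upwards [lt_mem_nhds hx] with y hy using log_Gamma_add_one hy
  rw [h₁.unique (h₂.congr_of_eventuallyEq h₃), one_div, add_comm]

lemma slope_log_Gamma {x : ℝ} (hx : 0 < x) :
    slope (fun y ↦ log (Gamma y)) x (x + 1) = log x := by
  rw [slope_def_field, log_Gamma_add_one hx]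
  ring

lemma digamma_le_log {x : ℝ} (hx : 0 < x) : digamma x ≤ log x := by
  rw [← slope_log_Gamma hx]
  exact convexOn_log_Gamma.le_slope_of_hasDerivAt (Set.mem_Ioi.2 hx)
    (Set.mem_Ioi.2 (by positivity)) (lt_add_one x) (hasDerivAt_log_Gamma hx)

lemma log_le_digamma_add_one {x : ℝ} (hx : 0 < x) : log x ≤ digamma (x + 1) := by
  rw [← slope_log_Gamma hx]
  exact convexOn_log_Gamma.slope_le_of_hasDerivAt (Set.mem_Ioi.2 hx)
    (Set.mem_Ioi.2 (by positivity)) (lt_add_one x) (hasDerivAt_log_Gamma (by positivity))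

lemma abs_digamma_sub_log_le {x : ℝ} (hx : 0 < x) : |digamma x - log x| ≤ 1 / x := by
  have h₁ := digamma_le_log hx
  have h₂ := log_le_digamma_add_one hx
  rw [digamma_add_one hx] at h₂
  rw [abs_le]
  constructor <;> linarith [one_div_pos.2 hx]

lemma digamma_add_natCast {x : ℝ} (hx : 0 < x) (N : ℕ) :
    digamma (x + N) = digamma x + ∑ m ∈ range N, 1 / (x + m) := by
  induction N with
  | zero => simp
  | succ N ih =>
    rw [sum_range_succ, Nat.cast_succ, ← add_assoc, digamma_add_one (by positivity), ih, add_assoc]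

lemma abs_digamma_add_sum_sub_log_le {x : ℝ} (hx : 0 < x) (N : ℕ) :
    |digamma x + 1 / x + ∑ m ∈ range N, 1 / (x + (m + 1)) - log (x + N)| ≤ 1 / (x + N) := by
  have hN : 0 < x + N := by positivity
  have h : digamma x + 1 / x + ∑ m ∈ range N, 1 / (x + (m + 1)) = digamma (x + N + 1) := by
    have := digamma_add_natCast hx (N + 1)
    rw [sum_range_succ'] at this
    push_cast at this
    rw [add_assoc x, this]
    simp only [add_zero]
    ring
  rw [h, abs_le]
  have h₁ := digamma_le_log hN
  have h₂ := log_le_digamma_add_one hN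
  have h₃ := digamma_add_one hN
  constructor <;> linarith [one_div_pos.2 hN]

end Digamma

section HerglotzSeries

lemma hasSum_one_div_succ_sq : HasSum (fun n : ℕ ↦ 1 / ((n : ℝ) + 1) ^ 2) (π ^ 2 / 6) := by
  simpa using (hasSum_nat_add_iff' 1).2 hasSum_zeta_two

lemma summable_herglotz {x : ℝ} (hx : 0 < x) : Summable fun n : ℕ ↦
    (digamma (((n : ℝ) + 1) * x) - log (((n : ℝ) + 1) * x)) / ((n : ℝ) + 1) := by
  refine .of_norm_bounded (hasSum_one_div_succ_sq.summable.mul_left x⁻¹) fun n ↦ ?_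
  have hn : (0 : ℝ) < n + 1 := by positivity
  rw [norm_div, norm_eq_abs, norm_eq_abs, abs_of_pos hn, div_le_iff₀ hn]
  refine (abs_digamma_sub_log_le (by positivity)).trans_eq ?_
  field_simp

/-- The partial sums of the Herglotz series. -/
noncomputable def herglotzPartial (N : ℕ) (x : ℝ) : ℝ :=
  ∑ n ∈ range N, (digamma (((n : ℝ) + 1) * x) - log (((n : ℝ) + 1) * x)) / ((n : ℝ) + 1)

lemma tendsto_herglotzPartial {x : ℝ} (hx : 0 < x) :
    Tendsto (herglotzPartial · x) atTop (𝓝 (herglotzF x)) :=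
  (summable_herglotz hx).hasSum.tendsto_sum_nat

/-- The partial sums of the Herglotz series, with the digamma function replaced by its `N`-th
elementary approximation. -/
noncomputable def herglotzApprox (N : ℕ) (x : ℝ) : ℝ :=
  ∑ n ∈ range N, (log (((n : ℝ) + 1) * x + N) - log (((n : ℝ) + 1) * x) - 1 / (((n : ℝ) + 1) * x)
    - ∑ m ∈ range N, 1 / (((n : ℝ) + 1) * x + (m + 1))) / ((n : ℝ) + 1)

lemma tendsto_herglotzApprox {x : ℝ} (hx : 0 < x) :
    Tendsto (herglotzApprox · x) atTop (𝓝 (herglotzF x)) := by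
  have h₀ : Tendsto (fun N : ℕ ↦ (N : ℝ)⁻¹ * ∑ n ∈ range N, 1 / ((n : ℝ) + 1)) atTop (𝓝 0) :=
    tendsto_one_div_add_atTop_nhds_zero_nat.cesaro
  have h₁ : Tendsto (fun N ↦ herglotzPartial N x - herglotzApprox N x) atTop (𝓝 0) := by
    refine squeeze_zero_norm' ?_ h₀
    filter_upwards [eventually_gt_atTop 0] with N hN
    have hN' : (0 : ℝ) < N := by exact_mod_cast hN
    rw [herglotzPartial, herglotzApprox, ← sum_sub_distrib, mul_sum]
    refine norm_sum_le_of_le _ fun n _ ↦ ?_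
    have hn : (0 : ℝ) < n + 1 := by positivity
    have hnx : (0 : ℝ) < (n + 1) * x := by positivity
    rw [← sub_div, norm_div, norm_eq_abs, norm_eq_abs, abs_of_pos hn, mul_one_div]
    gcongr
    calc _ = _ := by congr 1; ring
      _ ≤ 1 / (((n : ℝ) + 1) * x + N) := abs_digamma_add_sum_sub_log_le hnx N
      _ ≤ (N : ℝ)⁻¹ := by
        rw [one_div]
        gcongr
        linarith
  simpa using (tendsto_herglotzPartial hx).sub h₁

lemma sum_sum_add_sum_sum_inv {x : ℝ} (hx : 0 < x) (N : ℕ) :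
    ∑ n ∈ range N, (∑ m ∈ range N, 1 / (((n : ℝ) + 1) * x + (m + 1))) / ((n : ℝ) + 1) +
      ∑ n ∈ range N, (∑ m ∈ range N, 1 / (((n : ℝ) + 1) * x⁻¹ + (m + 1))) / ((n : ℝ) + 1) =
    (∑ n ∈ range N, 1 / ((n : ℝ) + 1)) ^ 2 := by
  simp only [sum_div]
  rw [add_comm, sum_comm, add_comm, ← sum_add_distrib, sq, sum_mul_sum]
  refine sum_congr rfl fun n _ ↦ ?_
  rw [← sum_add_distrib]
  refine sum_congr rfl fun m _ ↦ ?_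
  have h₁ : (0 : ℝ) < (n + 1) * x + (m + 1) := by positivity
  have h₂ : ((m : ℝ) + 1) * x⁻¹ + (n + 1) = ((n + 1) * x + (m + 1)) / x := by
    field_simp
    ring
  rw [h₂]
  field_simp
  ring

end HerglotzSeries

section LogSum

lemma abs_sum_sub_log_le {a b : ℝ} (ha : 0 < a) (hb : 0 < b) (N : ℕ) :
    |∑ n ∈ range N, a / (((n : ℝ) + 1) * a + b) - (log (N * a + b) - log b)| ≤ a / b := by
  have key : ∀ N : ℕ, ∑ n ∈ range N, a / (((n : ℝ) + 1) * a + b) ≤ log (N * a + b) - log b ∧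
      log (N * a + b) - log b ≤
        ∑ n ∈ range N, a / (((n : ℝ) + 1) * a + b) + (a / b - a / (N * a + b)) := by
    intro N
    induction N with
    | zero => simp
    | succ N ih =>
      have h₁ : (0 : ℝ) < N * a + b := by positivity
      have h₂ : (0 : ℝ) < (N + 1) * a + b := by positivity
      have h₃ := one_sub_inv_le_log_of_pos (div_pos h₂ h₁)
      have h₄ := log_le_sub_one_of_pos (div_pos h₂ h₁)
      rw [log_div h₂.ne' h₁.ne'] at h₃ h₄
      have h₅ : 1 - (((N + 1) * a + b) / (N * a + b))⁻¹ = a / ((N + 1) * a + b) := by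
        field_simp
        ring
      have h₆ : ((N + 1) * a + b) / (N * a + b) - 1 = a / (N * a + b) := by
        field_simp
        ring
      rw [sum_range_succ]
      push_cast
      constructor <;> linarith [ih.1, ih.2]
  have h : 0 ≤ a / (N * a + b) := by positivity
  rw [abs_le]
  constructor <;> linarith [key N, (key N).1, (key N).2, div_pos ha hb]

/-- The sum that carries the logarithmic terms of the inversion formula. -/
noncomputable def logSum (N : ℕ) (x : ℝ) : ℝ :=
  ∑ n ∈ range N, (log (((n : ℝ) + 1) * x + N) + log (((n : ℝ) + 1) * x⁻¹ + N)
    - 2 * log (((n : ℝ) + 1) * 1 + N)) / ((n : ℝ) + 1)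

lemma hasDerivAt_logSum {x : ℝ} (hx : 0 < x) (N : ℕ) :
    HasDerivAt (logSum N) ((∑ n ∈ range N, x / (((n : ℝ) + 1) * x + N) -
      ∑ n ∈ range N, 1 / (((n : ℝ) + 1) * 1 + N * x)) / x) x := by
  rw [← sum_sub_distrib, sum_div]
  refine HasDerivAt.fun_sum fun n _ ↦ ?_
  have h₁ : (0 : ℝ) < (n + 1) * x + N := by positivity
  have h₂ : (0 : ℝ) < (n + 1) * x⁻¹ + N := by positivity
  have h₃ : (0 : ℝ) < n + 1 + N * x := by positivity
  have h₄ : ((n : ℝ) + 1) * x⁻¹ + N = (n + 1 + N * x) / x := by field_simp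
  have d₁ := (((hasDerivAt_id x).const_mul ((n : ℝ) + 1)).add_const (N : ℝ)).log h₁.ne'
  have d₂ := (((hasDerivAt_inv hx.ne').const_mul ((n : ℝ) + 1)).add_const (N : ℝ)).log h₂.ne'
  refine (((d₁.add d₂).sub_const _).div_const _).congr_deriv ?_
  simp only [id_eq, mul_one, h₄]
  field_simp
  ring

lemma abs_logSum_sub_le {x : ℝ} (hx : 0 < x) {N : ℕ} (hN : 0 < N) :
    |logSum N x - log x ^ 2 / 2| ≤ (2 + (x⁻¹) ^ 2) / N * |x - 1| := by
  have hN' : (0 : ℝ) < N := by exact_mod_cast hN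
  have hpos : ∀ u ∈ Set.uIcc 1 x, 0 < u := fun u hu ↦
    (lt_min one_pos hx).trans_le hu.1
  have hd : ∀ u ∈ Set.uIcc 1 x, HasDerivWithinAt (fun u ↦ logSum N u - log u ^ 2 / 2)
      ((∑ n ∈ range N, u / (((n : ℝ) + 1) * u + N) -
        ∑ n ∈ range N, 1 / (((n : ℝ) + 1) * 1 + N * u)) / u - log u / u) (Set.uIcc 1 x) u := by
    intro u hu
    have hu := hpos u hu
    refine HasDerivAt.hasDerivWithinAt ?_
    refine ((hasDerivAt_logSum hu N).sub
      (((hasDerivAt_log hu.ne').pow 2).div_const 2)).congr_deriv ?_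
    field_simp
    simp
    ring
  have hbound : ∀ u ∈ Set.uIcc 1 x, ‖(∑ n ∈ range N, u / (((n : ℝ) + 1) * u + N) -
      ∑ n ∈ range N, 1 / (((n : ℝ) + 1) * 1 + N * u)) / u - log u / u‖ ≤
      (2 + (x⁻¹) ^ 2) / N := by
    intro u hu
    have hu₀ := hpos u hu
    have h₁ := abs_sum_sub_log_le hu₀ hN' N
    have h₂ := abs_sum_sub_log_le one_pos (mul_pos hN' hu₀) N
    have e₁ : log (N * u + N) - log N = log (1 + u) := by
      rw [← log_div (by positivity) (by positivity)]
      congr 1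
      field_simp
      ring
    have e₂ : log (N * 1 + N * u) - log (N * u) = log (1 + u) - log u := by
      rw [← mul_add, log_mul (by positivity) (by positivity), log_mul hN'.ne' hu₀.ne']
      ring
    rw [e₁] at h₁
    rw [e₂] at h₂
    have h₃ : |(∑ n ∈ range N, u / (((n : ℝ) + 1) * u + N) -
      ∑ n ∈ range N, 1 / (((n : ℝ) + 1) * 1 + N * u)) - log u| ≤ u / N + 1 / (N * u) := by
      rw [abs_le] at *
      constructor <;> linarith [h₁.1, h₁.2, h₂.1, h₂.2]
    rw [← sub_div, norm_div, norm_eq_abs, norm_of_nonneg hu₀.le, div_le_iff₀ hu₀]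
    refine h₃.trans ?_
    have h₄ : (u⁻¹) ^ 2 ≤ 1 + (x⁻¹) ^ 2 := by
      rcases le_total 1 x with h | h
      · rw [Set.uIcc_of_le h] at hu
        have : (u⁻¹) ^ 2 ≤ 1 := pow_le_one₀ (by positivity) (inv_le_one_of_one_le₀ hu.1)
        linarith [sq_nonneg x⁻¹]
      · rw [Set.uIcc_of_ge h] at hu
        have : (u⁻¹) ^ 2 ≤ (x⁻¹) ^ 2 := pow_le_pow_left₀ (by positivity) (inv_anti₀ hx hu.1) 2
        linarith
    calc u / N + 1 / (N * u) = (1 + (u⁻¹) ^ 2) / N * u := by field_simp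
      _ ≤ (2 + (x⁻¹) ^ 2) / N * u := by
        have h₅ : 1 + (u⁻¹) ^ 2 ≤ 2 + (x⁻¹) ^ 2 := by linarith
        exact mul_le_mul_of_nonneg_right (div_le_div_of_nonneg_right h₅ hN'.le) hu₀.le
  have h := (convex_uIcc (1 : ℝ) x).norm_image_sub_le_of_norm_hasDerivWithin_le hd hbound
    Set.left_mem_uIcc Set.right_mem_uIcc
  have h₁ : logSum N 1 = 0 := sum_eq_zero fun n _ ↦ by rw [inv_one]; ring
  simpa [h₁] using h

lemma tendsto_logSum {x : ℝ} (hx : 0 < x) :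
    Tendsto (logSum · x) atTop (𝓝 (log x ^ 2 / 2)) := by
  rw [← tendsto_sub_nhds_zero_iff]
  refine squeeze_zero_norm' (eventually_gt_atTop 0 |>.mono fun N ↦ abs_logSum_sub_le hx) ?_
  simpa only [zero_mul] using (tendsto_const_div_atTop_nhds_zero_nat (2 + (x⁻¹) ^ 2)).mul_const |x - 1|

end LogSum

lemma herglotzApprox_add_inv {x : ℝ} (hx : 0 < x) (N : ℕ) :
    herglotzApprox N x + herglotzApprox N x⁻¹ = 2 * herglotzApprox N 1 + logSum N x
      - (x + x⁻¹ - 2) * ∑ n ∈ range N, 1 / ((n : ℝ) + 1) ^ 2 := by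
  have expand : ∀ y : ℝ, 0 < y → herglotzApprox N y =
      ∑ n ∈ range N, log (((n : ℝ) + 1) * y + N) / ((n : ℝ) + 1)
      - ∑ n ∈ range N, log ((n : ℝ) + 1) / ((n : ℝ) + 1)
      - log y * ∑ n ∈ range N, 1 / ((n : ℝ) + 1)
      - y⁻¹ * ∑ n ∈ range N, 1 / ((n : ℝ) + 1) ^ 2
      - ∑ n ∈ range N, (∑ m ∈ range N, 1 / (((n : ℝ) + 1) * y + (m + 1))) / ((n : ℝ) + 1) := by
    intro y hy
    rw [herglotzApprox, mul_sum, mul_sum]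
    simp only [← sum_sub_distrib]
    refine sum_congr rfl fun n _ ↦ ?_
    rw [log_mul (by positivity) hy.ne']
    field_simp
    ring
  have hlog : logSum N x = ∑ n ∈ range N, log (((n : ℝ) + 1) * x + N) / ((n : ℝ) + 1)
      + ∑ n ∈ range N, log (((n : ℝ) + 1) * x⁻¹ + N) / ((n : ℝ) + 1)
      - 2 * ∑ n ∈ range N, log (((n : ℝ) + 1) * 1 + N) / ((n : ℝ) + 1) := by
    rw [logSum, mul_sum, ← sum_add_distrib, ← sum_sub_distrib]
    refine sum_congr rfl fun n _ ↦ ?_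
    ring
  have h₁ := sum_sum_add_sum_sum_inv hx N
  have h₂ := sum_sum_add_sum_sum_inv one_pos N
  rw [inv_one] at h₂
  rw [expand x hx, expand x⁻¹ (inv_pos.2 hx), expand 1 one_pos, hlog, log_inv, log_one, inv_inv,
    inv_one]
  linear_combination h₂ - h₁

theorem herglotzF_inversion (x : ℝ) (hx : 0 < x) :
    herglotzF x + herglotzF (1 / x) =
      2 * herglotzF 1 + Real.log x ^ 2 / 2 - Real.pi ^ 2 * (x - 1) ^ 2 / (6 * x) := by
  have h := (tendsto_herglotzApprox hx).add (tendsto_herglotzApprox (inv_pos.2 hx))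
  simp only [herglotzApprox_add_inv hx] at h
  have h' := (((tendsto_herglotzApprox one_pos).const_mul 2).add (tendsto_logSum hx)).sub
    (hasSum_one_div_succ_sq.tendsto_sum_nat.const_mul (x + x⁻¹ - 2))
  rw [one_div, tendsto_nhds_unique h h']
  field_simp
  ring
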